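/- Let {η_i, F_i}_{i≥1} be a sequence of martingale differences (E[η_i | F_{i−1}] = 0) with |η_i|_p := (E|η_i|^p)^{1/p} < ∞ for some p ≥ 2, and let d > 0. Then for every n, P(Σ_{i=1}^n η_i > n d) ≤ d^{−p} (p−1)^p n^{−p/2} { n^{−1} Σ_{i=1}^n |η_i|_p² }^{p/2}. -/

import Mathlib

open MeasureTheory Real

theorem one_add_rpow_mul_le {q b : ℝ} (hq : 1 ≤ q) (hb₀ : 0 ≤ b) (hb₁ : b < 1) :
    (1 + b) ^ q * (1 - q * b) ≤ (1 - b) ^ q * (1 + q * b) := by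
  have hA : 0 < (1 + b) ^ q := by positivity
  have hB : 0 < (1 - b) ^ q := rpow_pos_of_pos (by linarith) q
  have hqb : 0 ≤ q * b := by positivity
  rcases le_or_gt 1 (q * b) with h | h
  · exact (mul_nonpos_of_nonneg_of_nonpos hA.le (by linarith)).trans (by positivity)
  · have key : q * (log (1 + b) - log (1 - b)) ≤ log (1 + q * b) - log (1 - q * b) := by
      refine hasSum_le (fun k ↦ ?_)
        ((hasSum_log_sub_log_of_abs_lt_one (x := b) (by rwa [abs_of_nonneg hb₀])).mul_left q)
        (hasSum_log_sub_log_of_abs_lt_one (x := q * b) (by rwa [abs_of_nonneg hqb]))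
      have hqk : q ≤ q ^ (2 * k + 1) := le_self_pow₀ hq (by omega)
      rw [mul_pow]
      calc q * (2 * (1 / (2 * k + 1)) * b ^ (2 * k + 1))
          = 2 * (1 / (2 * k + 1)) * (q * b ^ (2 * k + 1)) := by ring
        _ ≤ _ := by gcongr
    rw [← log_le_log_iff (mul_pos hA (by linarith)) (by positivity),
      log_mul hA.ne' (by linarith), log_mul hB.ne' (by positivity), log_rpow (by linarith),
      log_rpow (by linarith)]
    linarith

theorem one_add_rpow_add_one_sub_rpow_le {p b : ℝ} (hp : 2 ≤ p) (hb₀ : 0 ≤ b) (hb₁ : b ≤ 1) :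
    (1 + b) ^ p + (1 - b) ^ p ≤ 2 * (1 + (p - 1) * b ^ 2) ^ (p / 2) := by
  have hpos (x : ℝ) : 0 < 1 + (p - 1) * x ^ 2 := by nlinarith [sq_nonneg x]
  let R : ℝ → ℝ := fun x ↦ ((1 + x) ^ p + (1 - x) ^ p) * (1 + (p - 1) * x ^ 2) ^ (-(p / 2))
  have hderiv (x : ℝ) : HasDerivAt R
      ((p * (1 + x) ^ (p - 1) - p * (1 - x) ^ (p - 1)) * (1 + (p - 1) * x ^ 2) ^ (-(p / 2))
        + ((1 + x) ^ p + (1 - x) ^ p) *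
          ((p - 1) * (2 * x) * (-(p / 2)) * (1 + (p - 1) * x ^ 2) ^ (-(p / 2) - 1))) x := by
    have h1 := ((hasDerivAt_id x).const_add 1).rpow_const (p := p) (Or.inr (by linarith))
    have h2 := ((hasDerivAt_id x).const_sub 1).rpow_const (p := p) (Or.inr (by linarith))
    have h3 := (((hasDerivAt_pow 2 x).const_mul (p - 1)).const_add 1).rpow_const
      (p := -(p / 2)) (Or.inl (hpos x).ne')
    convert! (h1.add h2).mul h3 using 1
    simp only [id_eq, Pi.add_apply, Nat.add_one_sub_one, pow_one, Nat.cast_ofNat]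
    ring
  have hanti : AntitoneOn R (Set.Icc 0 1) := by
    refine antitoneOn_of_deriv_nonpos (convex_Icc 0 1)
      (fun x _ ↦ (hderiv x).continuousAt.continuousWithinAt)
      (fun x _ ↦ (hderiv x).differentiableAt.differentiableWithinAt) fun x hx ↦ ?_
    rw [interior_Icc] at hx
    rw [(hderiv x).deriv]
    have e1 : (1 + x) ^ p = (1 + x) ^ (p - 1) * (1 + x) := by
      rw [← rpow_add_one (by linarith [hx.1]), sub_add_cancel]
    have e2 : (1 - x) ^ p = (1 - x) ^ (p - 1) * (1 - x) := by
      rw [← rpow_add_one (by linarith [hx.2]), sub_add_cancel]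
    have e3 : (1 + (p - 1) * x ^ 2) ^ (-(p / 2)) =
        (1 + (p - 1) * x ^ 2) ^ (-(p / 2) - 1) * (1 + (p - 1) * x ^ 2) := by
      rw [← rpow_add_one (hpos x).ne', sub_add_cancel]
    have key := one_add_rpow_mul_le (q := p - 1) (by linarith) hx.1.le hx.2
    have hC : 0 ≤ p * (1 + (p - 1) * x ^ 2) ^ (-(p / 2) - 1) :=
      mul_nonneg (by linarith) (rpow_nonneg (hpos x).le _)
    rw [e1, e2, e3]
    nlinarith [mul_nonneg hC (sub_nonneg.2 key)]
  have h := hanti (Set.left_mem_Icc.2 zero_le_one) ⟨hb₀, hb₁⟩ hb₀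
  simp only [R] at h
  rw [rpow_neg (hpos b).le, ← div_eq_mul_inv, div_le_iff₀ (rpow_pos_of_pos (hpos b) _)] at h
  norm_num at h
  linarith

theorem abs_add_rpow_add_abs_sub_rpow_le {p : ℝ} (hp : 2 ≤ p) (a b : ℝ) :
    |a + b| ^ p + |a - b| ^ p ≤ 2 * (a ^ 2 + (p - 1) * b ^ 2) ^ (p / 2) := by
  have ordered {a b : ℝ} (hb : 0 ≤ b) (hba : b ≤ a) :
      |a + b| ^ p + |a - b| ^ p ≤ 2 * (a ^ 2 + (p - 1) * b ^ 2) ^ (p / 2) := by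
    rcases (hb.trans hba).eq_or_lt with rfl | ha
    · obtain rfl : b = 0 := le_antisymm hba hb
      simp [zero_rpow (show p ≠ 0 by linarith), zero_rpow (show p / 2 ≠ 0 by linarith)]
    · have hle : b / a ≤ 1 := (div_le_one ha).2 hba
      have h := one_add_rpow_add_one_sub_rpow_le hp (b := b / a) (by positivity) hle
      have e1 : |a + b| = a * (1 + b / a) := by
        rw [abs_of_nonneg (by positivity)]; field_simp
      have e2 : |a - b| = a * (1 - b / a) := by
        rw [abs_of_nonneg (by linarith)]; field_simp
      have e3 : a ^ 2 + (p - 1) * b ^ 2 = a ^ 2 * (1 + (p - 1) * (b / a) ^ 2) := by field_simp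
      have e4 : (a ^ 2) ^ (p / 2) = a ^ p := by
        rw [← rpow_natCast, ← rpow_mul ha.le]; congr 1; push_cast; ring
      have hq : 0 ≤ p - 1 := by linarith
      rw [e1, e2, e3, mul_rpow ha.le (by positivity), mul_rpow ha.le (by linarith),
        mul_rpow (by positivity) (by positivity), e4]
      nlinarith [rpow_pos_of_pos ha p]
  have nonneg {a b : ℝ} (ha : 0 ≤ a) (hb : 0 ≤ b) :
      |a + b| ^ p + |a - b| ^ p ≤ 2 * (a ^ 2 + (p - 1) * b ^ 2) ^ (p / 2) := by
    rcases le_total b a with h | h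
    · exact ordered hb h
    · have := ordered ha h
      rw [add_comm b a, abs_sub_comm b a] at this
      refine this.trans ?_
      gcongr 2 * ?_ ^ _
      · nlinarith [sq_nonneg a, sq_nonneg b]
      · nlinarith [mul_nonneg (show 0 ≤ p - 2 by linarith) (show 0 ≤ b ^ 2 - a ^ 2 by nlinarith)]
  have h := nonneg (abs_nonneg a) (abs_nonneg b)
  rw [sq_abs, sq_abs] at h
  rcases abs_cases a with ⟨ha, _⟩ | ⟨ha, _⟩ <;> rcases abs_cases b with ⟨hb, _⟩ | ⟨hb, _⟩ <;>
    rw [ha, hb] at h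
  · exact h
  · rwa [sub_neg_eq_add, ← sub_eq_add_neg, add_comm (|a - b| ^ p)] at h
  · rwa [show -a + b = -(a - b) by ring, show -a - b = -(a + b) by ring, abs_neg, abs_neg,
      add_comm (|a - b| ^ p)] at h
  · rwa [show -a + -b = -(a + b) by ring, show -a - -b = -(a - b) by ring, abs_neg, abs_neg] at h

theorem le_add_of_second_difference_le {φ : ℝ → ℝ} {C : ℝ}
    (hφ : ∀ t s, φ (t + s) + φ (t - s) ≤ 2 * φ t + 2 * C * s ^ 2) (hmin : ∀ t, φ 0 ≤ φ t) :
    φ 1 ≤ φ 0 + C := by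
  have step (s : ℝ) (n : ℕ) : φ ((n + 1 : ℕ) * s) - φ (n * s) ≤ 2 * C * s ^ 2 * (n + 1) := by
    induction n with
    | zero =>
      have h1 := hφ 0 s
      have h2 := hmin (0 - s)
      simp only [zero_add, Nat.cast_one, one_mul, Nat.cast_zero, zero_mul, mul_one] at h1 h2 ⊢
      linarith
    | succ n ih =>
      have h := hφ ((n + 1 : ℕ) * s) s
      rw [show ((n + 1 : ℕ) : ℝ) * s + s = (n + 1 + 1 : ℕ) * s by push_cast; ring,
        show ((n + 1 : ℕ) : ℝ) * s - s = n * s by push_cast; ring] at h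
      push_cast at h ih ⊢
      linarith
  have total (s : ℝ) (n : ℕ) : φ (n * s) ≤ φ 0 + C * s ^ 2 * n * (n + 1) := by
    induction n with
    | zero => simp
    | succ n ih =>
      have h := step s n
      push_cast at h ⊢
      linarith
  have bound (n : ℕ) : φ 1 ≤ φ 0 + (C + C * (1 / ((n : ℝ) + 1))) := by
    have h := total (1 / ((n : ℝ) + 1)) (n + 1)
    have hn : (n : ℝ) + 1 ≠ 0 := by positivity
    have e : C * (1 / ((n : ℝ) + 1)) ^ 2 * (n + 1 : ℕ) * ((n + 1 : ℕ) + 1) =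
        C + C * (1 / ((n : ℝ) + 1)) := by
      push_cast; field_simp
    rwa [e, Nat.cast_add_one, mul_one_div_cancel hn] at h
  refine ge_of_tendsto' (x := .atTop) ?_ bound
  simpa using (((tendsto_one_div_add_atTop_nhds_zero_nat (𝕜 := ℝ)).const_mul C).const_add C).const_add
    (φ 0)

section LpNorm

variable {Ω : Type*} {m0 : MeasurableSpace Ω} {μ : Measure Ω}

theorem lpNorm_ofReal_eq_integral {p : ℝ} (hp : 0 < p) {f : Ω → ℝ}
    (hf : AEStronglyMeasurable f μ) :
    lpNorm f (ENNReal.ofReal p) μ = (∫ ω, |f ω| ^ p ∂μ) ^ p⁻¹ := by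
  rw [lpNorm_eq_integral_norm_rpow_toReal (by simpa using hp) ENNReal.ofReal_ne_top hf,
    ENNReal.toReal_ofReal hp.le]
  rfl

theorem lpNorm_ofReal_rpow {p : ℝ} (hp : 0 < p) {f : Ω → ℝ} (hf : AEStronglyMeasurable f μ) :
    lpNorm f (ENNReal.ofReal p) μ ^ p = ∫ ω, |f ω| ^ p ∂μ := by
  rw [lpNorm_ofReal_eq_integral hp hf,
    rpow_inv_rpow (integral_nonneg fun ω ↦ rpow_nonneg (abs_nonneg _) p) hp.ne']

theorem memLp_ofReal_iff {p : ℝ} (hp : 0 < p) {f : Ω → ℝ} (hf : AEStronglyMeasurable f μ) :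
    MemLp f (ENNReal.ofReal p) μ ↔ Integrable (fun ω ↦ |f ω| ^ p) μ := by
  rw [← integrable_norm_rpow_iff hf (by simpa using hp) ENNReal.ofReal_ne_top,
    ENNReal.toReal_ofReal hp.le]
  rfl

theorem abs_sq_rpow_half (x p : ℝ) : |x ^ 2| ^ (p / 2) = |x| ^ p := by
  rw [abs_pow, ← rpow_natCast, ← rpow_mul (abs_nonneg x)]
  congr 1; push_cast; ring

theorem lpNorm_sq_half {p : ℝ} (hp : 0 < p) {f : Ω → ℝ} (hf : AEStronglyMeasurable f μ) :
    lpNorm (f ^ 2) (ENNReal.ofReal (p / 2)) μ = lpNorm f (ENNReal.ofReal p) μ ^ 2 := by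
  rw [lpNorm_ofReal_eq_integral (half_pos hp) (hf.pow 2), lpNorm_ofReal_eq_integral hp hf]
  simp only [Pi.pow_apply, abs_sq_rpow_half]
  rw [← rpow_natCast, ← rpow_mul (integral_nonneg fun ω ↦ rpow_nonneg (abs_nonneg _) p)]
  congr 1; push_cast; field_simp

theorem MeasureTheory.MemLp.sq_half {p : ℝ} (hp : 0 < p) {f : Ω → ℝ}
    (hf : MemLp f (ENNReal.ofReal p) μ) : MemLp (f ^ 2) (ENNReal.ofReal (p / 2)) μ := by
  rw [memLp_ofReal_iff (half_pos hp) (hf.1.pow 2)]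
  simpa only [Pi.pow_apply, abs_sq_rpow_half] using (memLp_ofReal_iff hp hf.1).1 hf

/-- `L^p` is 2-uniformly smooth with constant `p - 1` for `p ≥ 2`. -/
theorem lpNorm_add_sq_add_lpNorm_sub_sq_le {p : ℝ} (hp : 2 ≤ p) {f g : Ω → ℝ}
    (hf : MemLp f (ENNReal.ofReal p) μ) (hg : MemLp g (ENNReal.ofReal p) μ) :
    lpNorm (f + g) (ENNReal.ofReal p) μ ^ 2 + lpNorm (f - g) (ENNReal.ofReal p) μ ^ 2 ≤
      2 * lpNorm f (ENNReal.ofReal p) μ ^ 2 +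
        2 * ((p - 1) * lpNorm g (ENNReal.ofReal p) μ ^ 2) := by
  have hp₀ : 0 < p := by linarith
  have hr₁ : 1 ≤ p / 2 := by linarith
  have hr₀ : 0 < p / 2 := by linarith
  have hq : 0 ≤ p - 1 := by linarith
  set u := lpNorm (f + g) (ENNReal.ofReal p) μ
  set v := lpNorm (f - g) (ENNReal.ofReal p) μ
  have hu : 0 ≤ u := lpNorm_nonneg
  have hv : 0 ≤ v := lpNorm_nonneg
  let h : Ω → ℝ := f ^ 2 + (p - 1) • g ^ 2
  have hh : MemLp h (ENNReal.ofReal (p / 2)) μ :=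
    (hf.sq_half hp₀).add ((hg.sq_half hp₀).const_smul (p - 1))
  have minkowski : lpNorm h (ENNReal.ofReal (p / 2)) μ ≤
      lpNorm f (ENNReal.ofReal p) μ ^ 2 + (p - 1) * lpNorm g (ENNReal.ofReal p) μ ^ 2 := by
    refine (lpNorm_add_le (hf.sq_half hp₀) (by simpa using hr₁)).trans_eq ?_
    rw [lpNorm_const_smul, lpNorm_sq_half hp₀ hf.1, lpNorm_sq_half hp₀ hg.1, coe_nnnorm,
      norm_of_nonneg hq]
  have pointwise : u ^ p + v ^ p ≤ 2 * lpNorm h (ENNReal.ofReal (p / 2)) μ ^ (p / 2) := by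
    rw [lpNorm_ofReal_rpow hp₀ (hf.add hg).1, lpNorm_ofReal_rpow hp₀ (hf.sub hg).1,
      lpNorm_ofReal_rpow hr₀ hh.1,
      ← integral_add ((memLp_ofReal_iff hp₀ (hf.add hg).1).1 (hf.add hg))
        ((memLp_ofReal_iff hp₀ (hf.sub hg).1).1 (hf.sub hg)), ← integral_const_mul]
    refine integral_mono (((memLp_ofReal_iff hp₀ (hf.add hg).1).1 (hf.add hg)).add
        ((memLp_ofReal_iff hp₀ (hf.sub hg).1).1 (hf.sub hg)))
      (((memLp_ofReal_iff hr₀ hh.1).1 hh).const_mul 2) fun ω ↦ ?_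
    have hnonneg : 0 ≤ f ω ^ 2 + (p - 1) * g ω ^ 2 := by positivity
    simpa [h, abs_of_nonneg hnonneg] using abs_add_rpow_add_abs_sub_rpow_le hp (f ω) (g ω)
  have power_mean : ((u ^ 2 + v ^ 2) / 2) ^ (p / 2) ≤ (u ^ p + v ^ p) / 2 := by
    have hconv := (convexOn_rpow hr₁).2 (Set.mem_Ici.2 (sq_nonneg u)) (Set.mem_Ici.2 (sq_nonneg v))
      one_half_pos.le one_half_pos.le (add_halves 1)
    have eu := abs_sq_rpow_half u p
    have ev := abs_sq_rpow_half v p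
    rw [abs_of_nonneg hu, abs_of_nonneg (sq_nonneg u)] at eu
    rw [abs_of_nonneg hv, abs_of_nonneg (sq_nonneg v)] at ev
    simp only [smul_eq_mul, eu, ev] at hconv
    rw [show (u ^ 2 + v ^ 2) / 2 = 1 / 2 * u ^ 2 + 1 / 2 * v ^ 2 by ring,
      show (u ^ p + v ^ p) / 2 = 1 / 2 * u ^ p + 1 / 2 * v ^ p by ring]
    exact hconv
  have hle : (u ^ 2 + v ^ 2) / 2 ≤ lpNorm h (ENNReal.ofReal (p / 2)) μ :=
    (rpow_le_rpow_iff (by positivity) lpNorm_nonneg hr₀).1 (by linarith)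
  linarith

theorem lpNorm_add_sq_le_of_condExp_eq_zero [IsFiniteMeasure μ] {p : ℝ} (hp : 2 ≤ p)
    {m : MeasurableSpace Ω} (hm : m ≤ m0) {X Y : Ω → ℝ} (hXm : StronglyMeasurable[m] X)
    (hX : MemLp X (ENNReal.ofReal p) μ) (hY : MemLp Y (ENNReal.ofReal p) μ)
    (hYm : μ[Y | m] =ᵐ[μ] 0) :
    lpNorm (X + Y) (ENNReal.ofReal p) μ ^ 2 ≤
      lpNorm X (ENNReal.ofReal p) μ ^ 2 + (p - 1) * lpNorm Y (ENNReal.ofReal p) μ ^ 2 := by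
  have hp₁ : (1 : ENNReal) ≤ ENNReal.ofReal p := by simpa using (by linarith : 1 ≤ p)
  have hmin (t : ℝ) : lpNorm X (ENNReal.ofReal p) μ ≤ lpNorm (X + t • Y) (ENNReal.ofReal p) μ := by
    have hcond : μ[X + t • Y | m] =ᵐ[μ] X := by
      filter_upwards [condExp_add (hX.integrable hp₁) ((hY.const_smul t).integrable hp₁) m,
        condExp_smul t Y m (μ := μ), hYm] with ω h1 h2 h3
      rw [h1, Pi.add_apply, h2, Pi.smul_apply, h3,
        condExp_of_stronglyMeasurable hm hXm (hX.integrable hp₁)]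
      simp
    have h := (hX.add (hY.const_smul t)).lpNorm_condExp_le_lpNorm (m := m) hp₁
    rwa [← toReal_eLpNorm integrable_condExp.1, eLpNorm_congr_ae hcond, toReal_eLpNorm hX.1] at h
  have h := le_add_of_second_difference_le
    (φ := fun t ↦ lpNorm (X + t • Y) (ENNReal.ofReal p) μ ^ 2)
    (C := (p - 1) * lpNorm Y (ENNReal.ofReal p) μ ^ 2) (fun t s ↦ ?_) (fun t ↦ ?_)
  · simpa using h
  · have h := lpNorm_add_sq_add_lpNorm_sub_sq_le hp (hX.add (hY.const_smul t)) (hY.const_smul s)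
    rw [lpNorm_const_smul s, coe_nnnorm, mul_pow, norm_eq_abs, sq_abs, add_assoc, ← add_smul,
      add_sub_assoc, ← sub_smul] at h
    linarith
  · simp only [zero_smul, add_zero]
    gcongr
    exacts [lpNorm_nonneg, hmin t]

theorem lpNorm_sum_martingale_difference_sq_le [IsFiniteMeasure μ] {p : ℝ} (hp : 2 ≤ p)
    (ℱ : Filtration ℕ m0) {η : ℕ → Ω → ℝ} (hadapted : StronglyAdapted ℱ η)
    (hLp : ∀ i, MemLp (η i) (ENNReal.ofReal p) μ)
    (hmdiff : ∀ i : ℕ, 1 ≤ i → μ[η i | ℱ (i - 1)] =ᵐ[μ] 0) (n : ℕ) :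
    lpNorm (∑ i ∈ Finset.Icc 1 n, η i) (ENNReal.ofReal p) μ ^ 2 ≤
      (p - 1) * ∑ i ∈ Finset.Icc 1 n, lpNorm (η i) (ENNReal.ofReal p) μ ^ 2 := by
  induction n with
  | zero => simp
  | succ n ih =>
    rw [Finset.sum_Icc_succ_top (by omega), Finset.sum_Icc_succ_top (by omega)]
    have hmeas : StronglyMeasurable[ℱ n] (∑ i ∈ Finset.Icc 1 n, η i) :=
      Finset.stronglyMeasurable_sum _ fun i hi ↦
        (hadapted i).mono (ℱ.mono (Finset.mem_Icc.1 hi).2)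
    have h := lpNorm_add_sq_le_of_condExp_eq_zero hp (ℱ.le n) hmeas
      (memLp_finsetSum' _ fun i _ ↦ hLp i) (hLp (n + 1)) (hmdiff (n + 1) (by omega))
    linarith

theorem measure_lt_toReal_le_lpNorm_rpow [IsFiniteMeasure μ] {p : ℝ} (hp : 0 < p) {f : Ω → ℝ}
    (hf : MemLp f (ENNReal.ofReal p) μ) {x : ℝ} (hx : 0 < x) :
    (μ {ω | x < f ω}).toReal ≤ x ^ (-p) * lpNorm f (ENNReal.ofReal p) μ ^ p := by
  have hmarkov := mul_meas_ge_le_integral_of_nonneg (μ := μ)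
    (.of_forall fun ω ↦ rpow_nonneg (abs_nonneg (f ω)) p) ((memLp_ofReal_iff hp hf.1).1 hf) (x ^ p)
  have hsub : μ.real {ω | x < f ω} ≤ μ.real {ω | x ^ p ≤ |f ω| ^ p} :=
    measureReal_mono fun ω hω ↦
      rpow_le_rpow hx.le ((le_of_lt hω).trans (le_abs_self _)) hp.le
  have hxp : 0 < x ^ p := rpow_pos_of_pos hx p
  rw [lpNorm_ofReal_rpow hp hf.1, rpow_neg hx.le, ← div_eq_inv_mul, le_div_iff₀ hxp, mul_comm]
  exact (mul_le_mul_of_nonneg_left hsub hxp.le).trans hmarkov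

end LpNorm

/-- **martingale moment bound.** Let `{η_i, F_i}` be a sequence of
martingale differences (`E[η_i | F_{i−1}] = 0`) with `|η_i|_p < ∞` for some `p ≥ 2`,
and let `d > 0`.  Then for every `n`,
`P(∑_{i=1}^n η_i > nd) ≤ d^{−p} (p−1)^p n^{−p/2} { n^{−1} ∑_{i=1}^n |η_i|_p² }^{p/2}`. -/
theorem martingale_difference_deviation_moment_bound
    {Ω : Type*} [m0 : MeasurableSpace Ω] (P : Measure Ω) [IsProbabilityMeasure P]
    (ℱ : Filtration ℕ m0) (η : ℕ → Ω → ℝ)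
    (hadapted : Adapted ℱ η)
    (hint : ∀ i, Integrable (η i) P)
    (hmdiff : ∀ i : ℕ, 1 ≤ i → P[η i | ℱ (i - 1)] =ᵐ[P] 0)
    (p : ℝ) (hp : 2 ≤ p)
    (hLp : ∀ i, Integrable (fun ω => |η i ω| ^ p) P)
    (d : ℝ) (hd : 0 < d) (n : ℕ) (hn : 1 ≤ n) :
    (P {ω | (n : ℝ) * d < ∑ i ∈ Finset.Icc 1 n, η i ω}).toReal
      ≤ d ^ (-p) * (p - 1) ^ p * (n : ℝ) ^ (-(p / 2))
          * ((n : ℝ)⁻¹ * ∑ i ∈ Finset.Icc 1 n,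
              ((∫ ω, |η i ω| ^ p ∂P) ^ (1 / p)) ^ (2 : ℝ)) ^ (p / 2) := by
  have hp₀ : 0 < p := by linarith
  have hq : 1 ≤ p - 1 := by linarith
  have hn₀ : (0 : ℝ) < n := by exact_mod_cast hn
  have hmem (i : ℕ) : MemLp (η i) (ENNReal.ofReal p) P :=
    (memLp_ofReal_iff hp₀ (hint i).1).2 (hLp i)
  have hsum := lpNorm_sum_martingale_difference_sq_le hp ℱ hadapted.stronglyAdapted hmem hmdiff n
  have htail := measure_lt_toReal_le_lpNorm_rpow hp₀
    (memLp_finsetSum' (Finset.Icc 1 n) fun i _ ↦ hmem i) (mul_pos hn₀ hd)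
  simp only [Finset.sum_apply] at htail
  have hnorm (i : ℕ) : ((∫ ω, |η i ω| ^ p ∂P) ^ (1 / p)) ^ (2 : ℝ) =
      lpNorm (η i) (ENNReal.ofReal p) P ^ 2 := by
    rw [lpNorm_ofReal_eq_integral hp₀ (hint i).1, one_div, rpow_ofNat]
  simp only [hnorm]
  set S := ∑ i ∈ Finset.Icc 1 n, lpNorm (η i) (ENNReal.ofReal p) P ^ 2
  set L := lpNorm (∑ i ∈ Finset.Icc 1 n, η i) (ENNReal.ofReal p) P
  have hL₀ : 0 ≤ L := lpNorm_nonneg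
  have hS : 0 ≤ S := Finset.sum_nonneg fun i _ ↦ sq_nonneg _
  have hL : L ^ p ≤ (p - 1) ^ p * S ^ (p / 2) := by
    have e (x : ℝ) (hx : 0 ≤ x) : (x ^ 2) ^ (p / 2) = x ^ p := by
      simpa [abs_of_nonneg hx] using abs_sq_rpow_half x p
    rw [← e L hL₀, ← e (p - 1) (by linarith), ← mul_rpow (sq_nonneg _) hS]
    refine rpow_le_rpow (sq_nonneg L) (hsum.trans ?_) (by linarith)
    gcongr
    nlinarith
  have hn_rpow : (n : ℝ) ^ (-(p / 2)) * (n : ℝ) ^ (-(p / 2)) = (n : ℝ) ^ (-p) := by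
    rw [← rpow_add hn₀]; congr 1; ring
  refine htail.trans ?_
  calc ((n : ℝ) * d) ^ (-p) * L ^ p
      ≤ ((n : ℝ) * d) ^ (-p) * ((p - 1) ^ p * S ^ (p / 2)) := by gcongr
    _ = _ := by
      rw [mul_rpow hn₀.le hd.le, mul_rpow (inv_nonneg.2 hn₀.le) hS, inv_rpow hn₀.le,
        ← rpow_neg hn₀.le, ← hn_rpow]
      ring
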